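/- arXiv:1702.03270 — 2 statements merged into one kernel-verified Lean document; each statement's English description precedes it below -/
import Mathlib

section
/- Let R be a countable commutative noetherian integral domain that is not a field, and let Q denote its field of fractions. Then Ext^1_R(Q, R) ≠ 0. -/
/-!
STATEMENT 1: If `R` is a countable commutative noetherian integral domain that is
not a field, and `Q = Frac(R)` is its field of fractions, then `Ext^1_R(Q, R) ≠ 0`.
-/

open CategoryTheory Opposite

universe v u

section ExtComparison

variable {R : Type*} [Ring R] {C : Type*} [Category* C] [Abelian C] [Linear R C]
  [EnoughProjectives C]

/-- If the derived-functor `Ext` vanishes in degree `n + 1`, then so does the `Ext`-group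
defined through the derived category. -/
theorem subsingleton_abelianExt_of_subsingleton_ext [HasExt.{v} C] {X Y : C} {n : ℕ}
    (h : Subsingleton (((Ext R C (n + 1)).obj (op X)).obj Y)) :
    Subsingleton (Abelian.Ext X Y (n + 1)) := by
  let P : ProjectiveResolution X := ProjectiveResolution.of X
  have h0 : Limits.IsZero ((P.complex.linearYonedaObj R Y).homology (n + 1)) :=
    (ModuleCat.isZero_of_subsingleton _).of_iso (P.isoExt (n + 1) Y).symm
  rw [← HomologicalComplex.exactAt_iff_isZero_homology,
    HomologicalComplex.exactAt_iff' _ n (n + 1) (n + 2) (by simp) (by simp),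
    ShortComplex.moduleCat_exact_iff] at h0
  refine subsingleton_of_forall_eq 0 fun α => ?_
  obtain ⟨f, hf, rfl⟩ := P.extMk_surjective α (n + 2) rfl
  rw [P.extMk_eq_zero_iff f (n + 2) rfl hf n rfl]
  exact h0 f hf

end ExtComparison

section Extension

variable {C : Type*} [Category* C] [Abelian C]

/-- If `Ext¹(S.X₃, Y) = 0` for a short exact sequence `S`, then every morphism `S.X₁ ⟶ Y` extends
along `S.f`. -/
theorem CategoryTheory.ShortComplex.ShortExact.exists_extension [HasExt.{v} C]
    {S : ShortComplex C} (hS : S.ShortExact) {Y : C} (h : Subsingleton (Abelian.Ext S.X₃ Y 1))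
    (φ : S.X₁ ⟶ Y) : ∃ g : S.X₂ ⟶ Y, S.f ≫ g = φ := by
  obtain ⟨x, hx⟩ := Abelian.Ext.contravariant_sequence_exact₁ hS Y (Abelian.Ext.mk₀ φ)
    (n₁ := 1) rfl (Subsingleton.elim _ _)
  obtain ⟨g, rfl⟩ := (Abelian.Ext.mk₀_bijective _ _).2 x
  rw [Abelian.Ext.mk₀_comp_mk₀] at hx
  exact ⟨g, (Abelian.Ext.mk₀_bijective _ _).1 hx⟩

end Extension

section Telescope

variable {R : Type*} [CommRing R]

/-- The endomorphism `eₙ ↦ eₙ - sₙ eₙ₊₁` of the free module on `ℕ`, whose cokernel is the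
colimit of `R → R → ⋯` along the multiplications by `sₙ`. -/
noncomputable def telescopeMap (s : ℕ → R) : (ℕ →₀ R) →ₗ[R] (ℕ →₀ R) :=
  Finsupp.linearCombination R fun n => Finsupp.single n 1 - Finsupp.single (n + 1) (s n)

theorem telescopeMap_single (s : ℕ → R) (n : ℕ) (r : R) :
    telescopeMap s (Finsupp.single n r) =
      Finsupp.single n r - Finsupp.single (n + 1) (r * s n) := by
  simp [telescopeMap, smul_sub]

theorem telescopeMap_apply_zero (s : ℕ → R) (x : ℕ →₀ R) : telescopeMap s x 0 = x 0 := by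
  induction x using Finsupp.induction_linear with
  | zero => simp
  | add f g hf hg => simp [hf, hg]
  | single n r => simp [telescopeMap_single]

theorem telescopeMap_apply_succ (s : ℕ → R) (x : ℕ →₀ R) (m : ℕ) :
    telescopeMap s x (m + 1) = x (m + 1) - x m * s m := by
  induction x using Finsupp.induction_linear with
  | zero => simp
  | add f g hf hg => simp only [map_add, Finsupp.add_apply, hf, hg]; ring
  | single n r =>
    rw [telescopeMap_single]
    by_cases h : n = m <;> simp [h, Finsupp.single_apply]

theorem telescopeMap_injective (s : ℕ → R) : Function.Injective (telescopeMap s) := by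
  rw [injective_iff_map_eq_zero]
  intro x hx
  ext n
  induction n with
  | zero => simpa [hx] using (telescopeMap_apply_zero s x).symm
  | succ m ih =>
    have h := telescopeMap_apply_succ s x m
    simp only [hx, ih] at h
    simpa using h.symm

theorem single_sub_single_mem_range_telescopeMap (s : ℕ → R) (n k : ℕ) (r : R) :
    ∃ r' : R, Finsupp.single n r - Finsupp.single (n + k) r' ∈
      LinearMap.range (telescopeMap s) := by
  induction k with
  | zero => exact ⟨r, by simp⟩
  | succ k ih =>
    obtain ⟨r', h⟩ := ih
    refine ⟨r' * s (n + k), ?_⟩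
    have h' := add_mem h (LinearMap.mem_range_self (telescopeMap s) (Finsupp.single (n + k) r'))
    rwa [telescopeMap_single, sub_add_sub_cancel] at h'

theorem exists_sub_single_mem_range_telescopeMap (s : ℕ → R) (x : ℕ →₀ R) :
    ∃ n r, x - Finsupp.single n r ∈ LinearMap.range (telescopeMap s) := by
  induction x using Finsupp.induction_linear with
  | zero => exact ⟨0, 0, by simp⟩
  | single n r => exact ⟨n, r, by simp⟩
  | add f g hf hg =>
    obtain ⟨n, r, hf⟩ := hf
    obtain ⟨m, t, hg⟩ := hg
    obtain ⟨r', hr⟩ := single_sub_single_mem_range_telescopeMap s n m r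
    obtain ⟨t', ht⟩ := single_sub_single_mem_range_telescopeMap s m n t
    rw [add_comm m n] at ht
    refine ⟨n + m, r' + t', ?_⟩
    convert add_mem (add_mem hf hr) (add_mem hg ht) using 1
    rw [Finsupp.single_add]
    abel

variable (K : Type*) [Field K] [Algebra R K]

/-- The map from the free module on `ℕ` to `K` sending `eₙ` to `(s₀ ⋯ sₙ₋₁)⁻¹`. -/
noncomputable def telescopeToField (s : ℕ → R) : (ℕ →₀ R) →ₗ[R] K :=
  Finsupp.linearCombination R fun n => (algebraMap R K (∏ i ∈ Finset.range n, s i))⁻¹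

theorem telescopeToField_single (s : ℕ → R) (n : ℕ) (r : R) :
    telescopeToField K s (Finsupp.single n r) =
      algebraMap R K r * (algebraMap R K (∏ i ∈ Finset.range n, s i))⁻¹ := by
  simp [telescopeToField, Algebra.smul_def]

variable [IsFractionRing R K]

theorem telescopeToField_telescopeMap {s : ℕ → R} (hs : ∀ n, s n ≠ 0) (x : ℕ →₀ R) :
    telescopeToField K s (telescopeMap s x) = 0 := by
  induction x using Finsupp.induction_linear with
  | zero => simp
  | add f g hf hg => simp [hf, hg]
  | single n r =>
    have h : algebraMap R K (s n) ≠ 0 := by simpa using hs n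
    rw [telescopeMap_single, map_sub, telescopeToField_single, telescopeToField_single,
      Finset.prod_range_succ, map_mul, map_mul, mul_inv]
    field_simp
    ring

variable [IsDomain R]

theorem exact_telescopeMap_telescopeToField {s : ℕ → R} (hs : ∀ n, s n ≠ 0) :
    Function.Exact (telescopeMap s) (telescopeToField K s) := by
  intro x
  refine ⟨fun hx => ?_, ?_⟩
  · obtain ⟨n, r, y, hy⟩ := exists_sub_single_mem_range_telescopeMap s x
    have h := telescopeToField_telescopeMap K hs y
    have hprod : ∏ i ∈ Finset.range n, s i ≠ 0 := Finset.prod_ne_zero_iff.2 fun i _ => hs i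
    rw [hy, map_sub, hx, telescopeToField_single, zero_sub, neg_eq_zero, mul_eq_zero,
      inv_eq_zero, FaithfulSMul.algebraMap_eq_zero_iff, FaithfulSMul.algebraMap_eq_zero_iff,
      or_iff_left hprod] at h
    exact ⟨y, by simpa [h] using hy⟩
  · rintro ⟨y, rfl⟩
    exact telescopeToField_telescopeMap K hs y

theorem telescopeToField_surjective {s : ℕ → R} (hs : ∀ n, s n ≠ 0)
    (hdvd : ∀ b : R, b ≠ 0 → ∃ n, b ∣ s n) : Function.Surjective (telescopeToField K s) := by
  intro q
  obtain ⟨a, b, hb, rfl⟩ := IsFractionRing.div_surjective (A := R) q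
  have hb0 : b ≠ 0 := nonZeroDivisors.ne_zero hb
  obtain ⟨n, hn⟩ := hdvd b hb0
  obtain ⟨c, hc⟩ : b ∣ ∏ i ∈ Finset.range (n + 1), s i :=
    hn.trans (Finset.dvd_prod_of_mem s (by simp))
  have hprod : ∏ i ∈ Finset.range (n + 1), s i ≠ 0 := Finset.prod_ne_zero_iff.2 fun i _ => hs i
  have hc0 : c ≠ 0 := by
    rintro rfl
    exact hprod (by simpa using hc)
  have hb' : algebraMap R K b ≠ 0 := by simpa using hb0
  have hc' : algebraMap R K c ≠ 0 := by simpa using hc0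
  refine ⟨Finsupp.single (n + 1) (a * c), ?_⟩
  rw [telescopeToField_single, hc, map_mul, map_mul]
  field_simp

end Telescope

/-- Over a countable domain, with all `sₙ` nonzero nonunits, the recurrence
`xₙ - sₙ xₙ₊₁ = aₙ` is not solvable for every sequence `a`. -/
theorem exists_not_solvable_recurrence {R : Type*} [CommRing R] [IsDomain R] [Countable R]
    {s : ℕ → R} (hs : ∀ n, s n ≠ 0) (hs' : ∀ n, ¬ IsUnit (s n)) :
    ∃ a : ℕ → R, ∀ x : ℕ → R, ∃ n, x n - s n * x (n + 1) ≠ a n := by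
  by_contra! h
  choose x hx using fun A : Set ℕ => h (A.indicator 1)
  have hinj : Function.Injective fun A => x A 0 := by
    intro A B h0
    have key (n : ℕ) (hn : x A n = x B n) :
        (n ∈ A ↔ n ∈ B) ∧ x A (n + 1) = x B (n + 1) := by
      have hA := hx A n
      have hB := hx B n
      rw [hn] at hA
      have hsub : s n * (x B (n + 1) - x A (n + 1)) =
          A.indicator 1 n - B.indicator 1 n := by
        linear_combination hA - hB
      have hmem : n ∈ A ↔ n ∈ B := by
        by_cases hnA : n ∈ A <;> by_cases hnB : n ∈ B <;>
          simp only [hnA, hnB, Set.indicator_of_mem, Set.indicator_of_notMem, not_false_eq_true,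
            Pi.one_apply] at hsub ⊢
        · exact (hs' n (IsUnit.of_mul_eq_one _ (hsub.trans (sub_zero 1)))).elim
        · exact (hs' n (IsUnit.of_mul_eq_one (x A (n + 1) - x B (n + 1))
            (by linear_combination -hsub))).elim
      refine ⟨hmem, ?_⟩
      have hind : A.indicator (1 : ℕ → R) n = B.indicator 1 n := by
        by_cases hnA : n ∈ A
        · simp [hnA, hmem.1 hnA]
        · simp [hnA, mt hmem.2 hnA]
      rw [hind, sub_self, mul_eq_zero, or_iff_right (hs n), sub_eq_zero] at hsub
      exact hsub.symm
    have heq (n : ℕ) : x A n = x B n := by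
      induction n with
      | zero => exact h0
      | succ n ih => exact (key n ih).2
    ext n
    exact (key n (heq n)).1
  have : Countable (Set ℕ) := hinj.countable
  obtain ⟨f, hf⟩ := exists_surjective_nat (Set ℕ)
  exact Function.cantor_surjective f hf

/-- In a countable domain that is not a field there is a sequence of nonzero nonunits such that
every nonzero element divides one of its terms. -/
theorem exists_cofinal_seq_nonunits {R : Type*} [CommRing R] [IsDomain R] [Countable R]
    (hR : ¬ IsField R) :
    ∃ s : ℕ → R, (∀ n, s n ≠ 0) ∧ (∀ n, ¬ IsUnit (s n)) ∧ ∀ b : R, b ≠ 0 → ∃ n, b ∣ s n := by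
  obtain ⟨p, hp0, hp⟩ := Ring.exists_not_isUnit_of_not_isField hR
  have : Nonempty {b : R // b ≠ 0} := ⟨⟨p, hp0⟩⟩
  obtain ⟨e, he⟩ := exists_surjective_nat {b : R // b ≠ 0}
  refine ⟨fun n => p * e n, fun n => mul_ne_zero hp0 (e n).2,
    fun n h => hp (isUnit_of_mul_isUnit_left h), fun b hb => ?_⟩
  obtain ⟨n, hn⟩ := he ⟨b, hb⟩
  exact ⟨n, by simp [hn]⟩

theorem ext_one_fractionField_ne_zero (R : Type u) [CommRing R] [IsDomain R]
    [IsNoetherianRing R] [Countable R] (hR : ¬ IsField R) :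
    Nontrivial (((Ext R (ModuleCat.{u} R) 1).obj
      (op (ModuleCat.of R (FractionRing R)))).obj (ModuleCat.of R R)) := by
  by_contra hExt
  rw [not_nontrivial_iff_subsingleton] at hExt
  obtain ⟨s, hs, hs', hdvd⟩ := exists_cofinal_seq_nonunits hR
  obtain ⟨a, ha⟩ := exists_not_solvable_recurrence hs hs'
  let S : ShortComplex (ModuleCat.{u} R) :=
    ShortComplex.mk (ModuleCat.ofHom (telescopeMap s))
      (ModuleCat.ofHom (telescopeToField (FractionRing R) s))
      (by ext1; exact LinearMap.ext (telescopeToField_telescopeMap (FractionRing R) hs))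
  have hS : S.ShortExact :=
    { exact := (ShortComplex.ShortExact.moduleCat_exact_iff_function_exact S).2
        (exact_telescopeMap_telescopeToField (FractionRing R) hs)
      mono_f := (ModuleCat.mono_iff_injective _).2 (telescopeMap_injective s)
      epi_g := (ModuleCat.epi_iff_surjective _).2
        (telescopeToField_surjective (FractionRing R) hs hdvd) }
  obtain ⟨g, hg⟩ := hS.exists_extension
    (subsingleton_abelianExt_of_subsingleton_ext.{u} hExt)
    (ModuleCat.ofHom (Finsupp.linearCombination R a))
  obtain ⟨n, hn⟩ := ha fun n => g.hom (Finsupp.single n 1)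
  apply hn
  have h : g.hom (telescopeMap s (Finsupp.single n 1)) =
      Finsupp.linearCombination R a (Finsupp.single n 1) :=
    congrArg (fun φ => φ.hom (Finsupp.single n 1)) hg
  have h1 : (Finsupp.single (n + 1) (1 * s n) : ℕ →₀ R) = s n • Finsupp.single (n + 1) 1 := by
    simp
  rw [telescopeMap_single, h1, Finsupp.linearCombination_single, one_smul] at h
  rw [← h]
  exact (by rw [map_sub, map_smul, smul_eq_mul] :
    g.hom (Finsupp.single n 1 - s n • Finsupp.single (n + 1) 1) = _).symm
end

section
/- Let k be a field and let S = k[x][[t]] be the ring of formal power series in t over the polynomial ring k[x]. Then the cosupport of S equals V((t)); that is, for every prime ideal q of S, there exists i with Ext^i_S(S_q, Λ^q S) ≠ 0 if and only if t ∈ q. -/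
open CategoryTheory Opposite

universe u

/-- The cosupport of a commutative ring `R`, as a subset of `Spec R`:
the primes `p` such that `Ext^i_R(R_p, Λ^p R) ≠ 0` for some `i`,
where `R_p` is the localization at `p` and `Λ^p R` the `p`-adic completion. -/
noncomputable def ringCosupport (R : Type u) [CommRing R] : Set (PrimeSpectrum R) :=
  { p | ∃ i : ℕ, Nontrivial (((Ext R (ModuleCat.{u} R) i).obj
      (op (ModuleCat.of R (Localization.AtPrime p.asIdeal)))).obj
      (ModuleCat.of R (AdicCompletion p.asIdeal R))) }

section Ext

open Limits

variable {R : Type u} [CommRing R]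

/-- The module `M` is derived complete with respect to `t`: infinite sums `∑ tʲ mⱼ` make sense
in `M`, in the form of unique tails. -/
def HasUniqueTails (t : R) (M : Type*) [AddCommGroup M] [Module R M] : Prop :=
  ∀ m : ℕ → M, ∃! s : ℕ → M, ∀ n, s n = m n + t • s (n + 1)

lemma HasUniqueTails.eq_zero {t : R} {M : Type*} [AddCommGroup M] [Module R M]
    (h : HasUniqueTails t M) {s : ℕ → M} (hs : ∀ n, s n = t • s (n + 1)) (n : ℕ) : s n = 0 :=
  congrFun ((h 0).unique (y₁ := s) (y₂ := 0) (by simpa using hs) (by simp)) n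

/-- A sequence of linear maps into a derived complete module has linear tails. -/
lemma HasUniqueTails.exists_linearMap {t : R} {M : Type*} [AddCommGroup M] [Module R M]
    (h : HasUniqueTails t M) {P : Type*} [AddCommGroup P] [Module R P] (b : ℕ → P →ₗ[R] M) :
    ∃ s : ℕ → P →ₗ[R] M, ∀ n, s n = b n + t • s (n + 1) := by
  choose s hs huniq using fun p ↦ h fun n ↦ b n p
  have hs' (p n) : s p n = b n p + t • s p (n + 1) := hs p n
  refine ⟨fun n ↦
    { toFun p := s p n
      map_add' p p' := ?_
      map_smul' r p := ?_ }, fun n ↦ LinearMap.ext fun p ↦ hs' p n⟩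
  · refine congrFun (huniq (p + p') (s p + s p') fun n ↦ ?_).symm n
    simp only [Pi.add_apply, map_add, smul_add]
    rw [hs' p n, hs' p' n]
    abel
  · refine congrFun (huniq (r • p) (r • s p) fun n ↦ ?_).symm n
    simp only [Pi.smul_apply, map_smul]
    rw [hs' p n, smul_add, smul_comm r t]

lemma subsingleton_ext_iff {N : ModuleCat.{u} R} (P : ProjectiveResolution N) (M : ModuleCat.{u} R)
    {i j : ℕ} (hj : (ComplexShape.up ℕ).prev i = j) :
    Subsingleton (((Ext R (ModuleCat.{u} R) i).obj (op N)).obj M) ↔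
      ∀ z : P.complex.X i ⟶ M, P.complex.d (i + 1) i ≫ z = 0 →
        ∃ b : P.complex.X j ⟶ M, P.complex.d i j ≫ b = z := by
  rw [← ModuleCat.isZero_iff_subsingleton, (P.isoExt i M).isZero_iff,
    ← HomologicalComplex.exactAt_iff_isZero_homology,
    HomologicalComplex.exactAt_iff' _ j i (i + 1) hj (by simp),
    ShortComplex.moduleCat_exact_iff]
  exact Iff.rfl

/-- `Ext` from a module on which `t` acts invertibly to a derived `t`-complete module vanishes. -/
theorem subsingleton_ext_of_hasUniqueTails {t : R} {N M : ModuleCat.{u} R} (e : N ⟶ N)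
    (he : t • e = 𝟙 N) (hM : HasUniqueTails t M) (i : ℕ) :
    Subsingleton (((Ext R (ModuleCat.{u} R) i).obj (op N)).obj M) := by
  let P := projectiveResolution N
  rw [subsingleton_ext_iff P M rfl]
  intro z hz
  let φ := ProjectiveResolution.lift e P P
  have H : Homotopy (𝟙 P.complex) (t • φ) := ProjectiveResolution.liftHomotopy (𝟙 N) _ _
    (by simp) (by
      rw [Linear.smul_comp, ProjectiveResolution.lift_commutes, ← he]
      refine HomologicalComplex.to_single_hom_ext ?_
      simp only [HomologicalComplex.smul_f_apply, HomologicalComplex.comp_f]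
      exact (Linear.comp_smul _ _ _ (P.π.f 0) t e).symm)
  let zs : ℕ → (P.complex.X i ⟶ M) := fun n ↦ Nat.rec z (fun _ w ↦ φ.f i ≫ w) n
  have zs_succ (n) : zs (n + 1) = φ.f i ≫ zs n := rfl
  have hzs (n) : P.complex.d (i + 1) i ≫ zs n = 0 := by
    induction n with
    | zero => exact hz
    | succ n ih => rw [zs_succ, ← Category.assoc, ← φ.comm, Category.assoc, ih, comp_zero]
  let j := (ComplexShape.up ℕ).prev i
  obtain ⟨s, hs⟩ := hM.exists_linearMap fun n ↦ (H.hom j i ≫ zs n).hom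
  let sm (n : ℕ) : P.complex.X j ⟶ M := ModuleCat.ofHom (s n)
  have hsm (n) : sm n = H.hom j i ≫ zs n + t • sm (n + 1) := by
    ext1
    exact hs n
  have hH : 𝟙 (P.complex.X i) = P.complex.d i j ≫ H.hom j i +
      H.hom i (i + 1) ≫ P.complex.d (i + 1) i + t • φ.f i := by
    have := H.comm i
    rwa [prevD_eq _ (show (ComplexShape.down ℕ).Rel (i + 1) i from rfl)] at this
  have key (n) : zs n - P.complex.d i j ≫ sm n =
      t • (zs (n + 1) - P.complex.d i j ≫ sm (n + 1)) := by
    have h1 : zs n = P.complex.d i j ≫ H.hom j i ≫ zs n + t • zs (n + 1) := by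
      conv_lhs => rw [← Category.id_comp (zs n), hH]
      simp [hzs, zs_succ]
    rw [hsm n, smul_sub, sub_eq_sub_iff_add_eq_add]
    conv_lhs => rw [h1]
    simp only [Preadditive.comp_add, Linear.comp_smul]
    abel
  refine ⟨sm 0, ?_⟩
  ext x
  exact (sub_eq_zero.mp (hM.eq_zero (s := fun n ↦ (zs n - P.complex.d i j ≫ sm n).hom x)
    (fun n ↦ by rw [key n]; rfl) 0)).symm

/-- If `Ext¹(N, K) = 0`, then maps from `N` lift along surjections with kernel `K`. -/
theorem exists_lift_of_subsingleton_ext_one {N : ModuleCat.{u} R}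
    {C : ShortComplex (ModuleCat.{u} R)}
    (hC : C.ShortExact) (hN : Subsingleton (((Ext R (ModuleCat.{u} R) 1).obj (op N)).obj C.X₁))
    (f : N ⟶ C.X₃) : ∃ g : N ⟶ C.X₂, g ≫ C.g = f := by
  have := hC.mono_f
  have := hC.epi_g
  let P := projectiveResolution N
  rw [subsingleton_ext_iff P C.X₁ (j := 0) (by simp)] at hN
  let p : P.complex.X 0 ⟶ N := P.π.f 0
  have hp : P.complex.d 1 0 ≫ p = 0 := P.complex_d_comp_π_f_zero
  have hexact : (ShortComplex.mk _ p hp).Exact := P.exact₀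
  have hepi : Epi p := inferInstanceAs (Epi (P.π.f 0))
  let g₀ : P.complex.X 0 ⟶ C.X₂ := Projective.factorThru (p ≫ f) C.g
  have hg₀ : g₀ ≫ C.g = p ≫ f := Projective.factorThru_comp _ _
  have hd : (P.complex.d 1 0 ≫ g₀) ≫ C.g = 0 := by
    rw [Category.assoc, hg₀, ← Category.assoc, hp, zero_comp]
  let z : P.complex.X 1 ⟶ C.X₁ := hC.exact.lift _ hd
  have hz : z ≫ C.f = P.complex.d 1 0 ≫ g₀ := hC.exact.lift_f _ hd
  obtain ⟨b, hb⟩ := hN z (by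
    rw [← cancel_mono C.f, Category.assoc, hz, ← Category.assoc, P.complex.d_comp_d, zero_comp,
      zero_comp])
  have hg : P.complex.d 1 0 ≫ (g₀ - b ≫ C.f) = 0 := by
    rw [Preadditive.comp_sub, ← hz, ← hb, Category.assoc, sub_self]
  refine ⟨hexact.desc _ hg, ?_⟩
  have h : p ≫ hexact.desc _ hg = g₀ - b ≫ C.f := hexact.g_desc _ hg
  rw [← cancel_epi p, ← Category.assoc, h]
  simp [hg₀]

end Ext

section Completion

variable {R : Type*} [CommRing R] {t : R}

/-- Derived completeness passes from a ring to its quotients by finitely generated ideals. -/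
lemma HasUniqueTails.quotient (h : HasUniqueTails t R) {J : Ideal R} (hJ : J.FG) :
    HasUniqueTails t (R ⧸ J) := by
  intro m
  choose m' hm' using fun n ↦ Ideal.Quotient.mk_surjective (m n)
  obtain ⟨s', hs', -⟩ := h m'
  refine ⟨fun n ↦ Ideal.Quotient.mk J (s' n), fun n ↦ ?_, fun u hu ↦ ?_⟩
  · simp only
    rw [← hm', hs' n, map_add]
    rfl
  · choose u' hu' using fun n ↦ Ideal.Quotient.mk_surjective (u n)
    obtain ⟨r, v, rfl⟩ := Submodule.fg_iff_exists_fin_generating_family.mp hJ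
    have hmem (n : ℕ) : u' n - s' n - t * (u' (n + 1) - s' (n + 1)) ∈
        Ideal.span (Set.range v) := by
      rw [← Ideal.Quotient.eq_zero_iff_mem]
      have h1 : Ideal.Quotient.mk _ (u' n) = m n + Ideal.Quotient.mk _ (t * u' (n + 1)) := by
        rw [hu', hu n, map_mul, hu']; rfl
      have h2 : Ideal.Quotient.mk (Ideal.span (Set.range v)) (s' n) =
          m n + Ideal.Quotient.mk _ (t * s' (n + 1)) := by
        rw [hs' n, map_add, hm']; rfl
      rw [mul_sub, map_sub, map_sub, map_sub, h1, h2]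
      ring
    choose c hc using fun n ↦ Ideal.mem_span_range_iff_exists_fun.mp (hmem n)
    choose w hw _ using fun l ↦ h fun n ↦ c n l
    have hw' (l n) : w l n = c n l + t * w l (n + 1) := hw l n
    have key (n) := h.eq_zero (s := fun n ↦ u' n - s' n - ∑ l, w l n * v l) (fun n ↦ by
      have : ∑ l, w l n * v l = ∑ l, c n l * v l + t * ∑ l, w l (n + 1) * v l := by
        rw [Finset.mul_sum, ← Finset.sum_add_distrib]
        exact Finset.sum_congr rfl fun l _ ↦ by rw [hw' l n]; ring
      simp only [smul_eq_mul]
      rw [this, hc n]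
      ring) n
    funext n
    rw [← hu' n]
    refine Ideal.Quotient.eq.mpr ?_
    rw [sub_eq_zero.mp (key n)]
    exact Ideal.mem_span_range_iff_exists_fun.mpr ⟨_, rfl⟩

/-- Adic completions of a derived `t`-complete noetherian ring are derived `t`-complete. -/
lemma HasUniqueTails.adicCompletion [IsNoetherianRing R] (h : HasUniqueTails t R) (I : Ideal R) :
    HasUniqueTails t (AdicCompletion I R) := by
  intro m
  have hq (N : ℕ) : HasUniqueTails t (R ⧸ (I ^ N • ⊤ : Ideal R)) :=
    h.quotient (Ideal.fg_of_isNoetherianRing _)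
  choose s hs huniq using fun N ↦ hq N fun n ↦ (m n).val N
  have hs' (N n) : s N n = (m n).val N + t • s N (n + 1) := hs N n
  refine ⟨fun n ↦ ⟨fun N ↦ s N n, fun {M N} hMN ↦ ?_⟩, fun n ↦ ?_, fun u hu ↦ ?_⟩
  · refine congrFun (huniq M (fun n ↦ AdicCompletion.transitionMap I R hMN (s N n)) fun n ↦ ?_) n
    simp only
    rw [hs' N n, map_add, map_smul, AdicCompletion.transitionMap_comp_eval_apply]
  · ext N
    exact hs N n
  · funext n
    ext N
    refine congrFun (huniq N (fun n ↦ (u n).val N) fun n ↦ ?_) n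
    simp only
    rw [hu n]
    rfl

open PowerSeries in
lemma PowerSeries.hasUniqueTails (A : Type*) [CommRing A] :
    HasUniqueTails (X : A⟦X⟧) A⟦X⟧ := by
  intro m
  refine ⟨fun n ↦ mk fun c ↦ ∑ j ∈ Finset.range (c + 1), coeff (c - j) (m (n + j)), fun n ↦ ?_,
    fun u hu ↦ ?_⟩
  · ext (_ | c)
    · simp
    · simp only [smul_eq_mul, coeff_mk, map_add, coeff_succ_X_mul]
      rw [Finset.sum_range_succ', add_comm]
      simp [add_assoc, add_comm 1]
  · simp only [smul_eq_mul] at hu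
    funext n
    ext c
    rw [coeff_mk]
    induction c generalizing n with
    | zero => rw [hu n]; simp
    | succ c ih =>
      rw [hu n, map_add, coeff_succ_X_mul, ih, Finset.sum_range_succ' _ (c + 1), add_comm]
      simp [add_assoc, add_comm 1]

open PowerSeries in
lemma PowerSeries.isAdicComplete_span_X (A : Type*) [CommRing A] :
    IsAdicComplete (Ideal.span {(X : A⟦X⟧)}) A⟦X⟧ where
  haus' f hf := by
    ext n
    have := hf (n + 1)
    rw [SModEq.zero, smul_eq_mul, Ideal.mul_top, Ideal.span_singleton_pow,
      Ideal.mem_span_singleton, X_pow_dvd_iff] at this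
    exact this n n.lt_succ_self
  prec' f hf := by
    refine ⟨mk fun n ↦ coeff n (f (n + 1)), fun n ↦ ?_⟩
    rw [SModEq.sub_mem, smul_eq_mul, Ideal.mul_top, Ideal.span_singleton_pow,
      Ideal.mem_span_singleton, X_pow_dvd_iff]
    intro c hc
    have := (hf (show c + 1 ≤ n from hc)).symm
    rw [SModEq.sub_mem, smul_eq_mul, Ideal.mul_top, Ideal.span_singleton_pow,
      Ideal.mem_span_singleton, X_pow_dvd_iff] at this
    simpa using this c c.lt_succ_self

end Completion

section GlobalCase

open PowerSeries

/-- The power series over `K` all of whose coefficients lie in the `A`-submodule `P` of `K`. -/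
def PowerSeries.submoduleCoeff {A K : Type*} [CommRing A] [CommRing K] [Algebra A K]
    (P : Submodule A K) : Submodule A⟦X⟧ K⟦X⟧ where
  carrier := {f | ∀ n, coeff n f ∈ P}
  add_mem' hf hg n := by simpa using P.add_mem (hf n) (hg n)
  zero_mem' n := by simp
  smul_mem' a f hf n := by
    rw [Algebra.smul_def, coeff_mul]
    refine P.sum_mem fun p _ ↦ ?_
    rw [show algebraMap A⟦X⟧ K⟦X⟧ = map (algebraMap A K) from rfl, coeff_map,
      ← Algebra.smul_def]
    exact P.smul_mem _ (hf _)

/-- If no nonzero element of `P` is divisible by all powers of `a`, then linear maps into the power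
series with coefficients in `P` kill every element divisible by all powers of `a`. -/
lemma PowerSeries.linearMap_apply_eq_zero {A K : Type*} [CommRing A] [CommRing K] [Algebra A K]
    {P : Submodule A K} {a : A} (hP : ∀ p ∈ P, (∀ n, ∃ p' ∈ P, p = a ^ n • p') → p = 0)
    {W : Type*} [AddCommGroup W] [Module A⟦X⟧ W] {w : W}
    (hw : ∀ n, ∃ w', w = (C a : A⟦X⟧) ^ n • w') (f : W →ₗ[A⟦X⟧] submoduleCoeff P) : f w = 0 := by
  ext c
  refine hP _ ((f w).2 c) fun n ↦ ?_
  obtain ⟨w', rfl⟩ := hw n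
  refine ⟨_, (f w').2 c, ?_⟩
  rw [map_smul, Submodule.coe_smul, Algebra.smul_def, ← map_pow,
    show algebraMap A⟦X⟧ K⟦X⟧ = map (algebraMap A K) from rfl, map_C, coeff_C_mul,
    ← Algebra.smul_def]

/-- A Mayer-Vietoris square `A = P ∩ B`, `K = P + B` inside a field `K`, where `P` and `B` are
separated with respect to the powers of nonzero elements `a` and `b`, gives the non-vanishing of
`Ext¹(A⟦X⟧_(X), A⟦X⟧)`. -/
theorem PowerSeries.not_subsingleton_ext_one {A K : Type u} [CommRing A] [Field K] [Algebra A K]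
    (hinj : Function.Injective (algebraMap A K)) {P B : Submodule A K} (hsup : P ⊔ B = ⊤)
    (hinf : P ⊓ B = 1) {a b : A} (ha : a ≠ 0) (hb : b ≠ 0)
    (hP : ∀ p ∈ P, (∀ n, ∃ p' ∈ P, p = a ^ n • p') → p = 0)
    (hB : ∀ p ∈ B, (∀ n, ∃ p' ∈ B, p = b ^ n • p') → p = 0)
    (q : Ideal A⟦X⟧) [q.IsPrime] (hq : ∀ f, f ∈ q ↔ constantCoeff f = 0)
    {M : Type u} [AddCommGroup M] [Module A⟦X⟧ M] (e : M ≃ₗ[A⟦X⟧] A⟦X⟧) :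
    ¬ Subsingleton (((Ext A⟦X⟧ (ModuleCat.{u} A⟦X⟧) 1).obj
      (op (ModuleCat.of A⟦X⟧ (Localization.AtPrime q)))).obj (ModuleCat.of A⟦X⟧ M)) := by
  intro hsub
  have hmap (f : A⟦X⟧) (n : ℕ) : coeff n (algebraMap A⟦X⟧ K⟦X⟧ f) = algebraMap A K (coeff n f) := by
    rw [show algebraMap A⟦X⟧ K⟦X⟧ = map (algebraMap A K) from rfl, coeff_map]
  have hmem (Q : Submodule A K) (hQ : 1 ≤ Q) (m : M) :
      algebraMap A⟦X⟧ K⟦X⟧ (e m) ∈ submoduleCoeff Q := fun n ↦ by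
    rw [hmap]
    exact hQ (Submodule.mem_one.mpr ⟨_, rfl⟩)
  let ι₀ : M →ₗ[A⟦X⟧] K⟦X⟧ := Algebra.linearMap A⟦X⟧ K⟦X⟧ ∘ₗ e.toLinearMap
  let ι : M →ₗ[A⟦X⟧] submoduleCoeff P × submoduleCoeff B :=
    (ι₀.codRestrict _ (hmem P (hinf.ge.trans inf_le_left))).prod
      (ι₀.codRestrict _ (hmem B (hinf.ge.trans inf_le_right)))
  let π : submoduleCoeff P × submoduleCoeff B →ₗ[A⟦X⟧] K⟦X⟧ :=
    (submoduleCoeff P).subtype.coprod (-(submoduleCoeff B).subtype)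
  have hι : Function.Injective ι := fun x y hxy ↦ by
    have h1 : algebraMap A⟦X⟧ K⟦X⟧ (e x) = algebraMap A⟦X⟧ K⟦X⟧ (e y) :=
      congrArg (fun z ↦ (z.1 : K⟦X⟧)) hxy
    refine e.injective (PowerSeries.ext fun n ↦ hinj ?_)
    rw [← hmap, ← hmap, h1]
  have hπ : Function.Surjective π := fun f ↦ by
    have h (n) : ∃ p ∈ P, ∃ r ∈ B, p + r = coeff n f :=
      Submodule.mem_sup.mp (hsup ▸ Submodule.mem_top)
    choose p hp r hr hpr using h
    refine ⟨(⟨mk p, fun n ↦ by simpa using hp n⟩, ⟨-mk r, fun n ↦ by simpa using hr n⟩), ?_⟩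
    ext n
    simp [π, hpr]
  have hexact : Function.Exact ι π := by
    rintro ⟨⟨p, hp⟩, ⟨r, hr⟩⟩
    constructor
    · intro h
      obtain rfl : p = r := by
        rw [← sub_eq_zero, ← h]
        simp [π, sub_eq_add_neg]
      have h1 (n) : ∃ c : A, algebraMap A K c = coeff n p :=
        Submodule.mem_one.mp (hinf ▸ Submodule.mem_inf.mpr ⟨hp n, hr n⟩)
      choose c hc using h1
      have h2 : algebraMap A⟦X⟧ K⟦X⟧ (mk c) = p := by
        ext n
        rw [hmap, coeff_mk, hc]
      refine ⟨e.symm (mk c), ?_⟩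
      have h3 := (congrArg (algebraMap A⟦X⟧ K⟦X⟧) (e.apply_symm_apply (mk c))).trans h2
      exact Prod.ext (Subtype.ext h3) (Subtype.ext h3)
    · rintro ⟨m, hm⟩
      rw [← hm]
      exact add_neg_cancel (algebraMap A⟦X⟧ K⟦X⟧ (e m))
  let S : ShortComplex (ModuleCat.{u} A⟦X⟧) :=
    ShortComplex.mk (ModuleCat.ofHom ι) (ModuleCat.ofHom π) (by
      ext1
      exact hexact.linearMap_comp_eq_zero)
  have hS : S.ShortExact :=
    { exact := (ShortComplex.ShortExact.moduleCat_exact_iff_function_exact S).mpr hexact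
      mono_f := (ModuleCat.mono_iff_injective _).mpr hι
      epi_g := (ModuleCat.epi_iff_surjective _).mpr hπ }
  let j : Localization.AtPrime q →ₐ[A⟦X⟧] K⟦X⟧ :=
    IsLocalization.liftAlgHom (M := q.primeCompl) (f := Algebra.ofId A⟦X⟧ K⟦X⟧) fun s ↦ by
      rw [PowerSeries.isUnit_iff_constantCoeff, isUnit_iff_ne_zero,
        ← coeff_zero_eq_constantCoeff_apply]
      change coeff 0 (algebraMap A⟦X⟧ K⟦X⟧ s) ≠ 0
      rw [hmap, map_ne_zero_iff _ hinj, coeff_zero_eq_constantCoeff_apply, Ne, ← hq]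
      exact s.2
  obtain ⟨g, hg⟩ := exists_lift_of_subsingleton_ext_one hS hsub (ModuleCat.ofHom j.toLinearMap)
  have hg' : π (g.hom 1) = 1 := (congrArg (fun l ↦ l.hom (1 : Localization.AtPrime q)) hg).trans
    (map_one j)
  have hdiv {c : A} (hc : c ≠ 0) (n : ℕ) :
      ∃ w : Localization.AtPrime q, 1 = (C c : A⟦X⟧) ^ n • w := by
    have hu : IsUnit (algebraMap A⟦X⟧ (Localization.AtPrime q) (C c ^ n)) := by
      rw [map_pow]
      refine (IsLocalization.map_units (M := q.primeCompl) _ ⟨C c, fun h ↦ hc ?_⟩).pow n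
      simpa using (hq _).mp h
    obtain ⟨w, hw⟩ := hu.exists_right_inv
    exact ⟨w, by rw [Algebra.smul_def, hw]⟩
  have h1 : (g.hom 1).1 = 0 := linearMap_apply_eq_zero hP (hdiv ha) (LinearMap.fst _ _ _ ∘ₗ g.hom)
  have h2 : (g.hom 1).2 = 0 := linearMap_apply_eq_zero hB (hdiv hb) (LinearMap.snd _ _ _ ∘ₗ g.hom)
  rw [show g.hom 1 = 0 from Prod.ext h1 h2, map_zero] at hg'
  exact zero_ne_one hg'

end GlobalCase

section Laurent

open PowerSeries LaurentSeries

variable (k : Type*) [Field k]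

instance LaurentSeries.isScalarTower_polynomial : IsScalarTower (Polynomial k) k⟦X⟧ k⸨X⸩ :=
  .of_algebraMap_eq fun _ ↦ rfl

/-- The power series inside the Laurent series, as a module over the polynomials. -/
noncomputable def LaurentSeries.powerSeriesSubmodule : Submodule (Polynomial k) k⸨X⸩ :=
  LinearMap.range (IsScalarTower.toAlgHom (Polynomial k) k⟦X⟧ k⸨X⸩).toLinearMap

/-- The Laurent polynomials inside the Laurent series, as a module over the polynomials. -/
def LaurentSeries.laurentPolynomialSubmodule : Submodule (Polynomial k) k⸨X⸩ where
  carrier := {f | ∃ (n : ℕ) (p : Polynomial k),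
    (Polynomial.X : Polynomial k) ^ n • f = algebraMap (Polynomial k) k⸨X⸩ p}
  add_mem' := by
    rintro f g ⟨n, p, hp⟩ ⟨m, r, hr⟩
    refine ⟨n + m, Polynomial.X ^ m * p + Polynomial.X ^ n * r, ?_⟩
    rw [smul_add, map_add, map_mul, map_mul, ← hp, ← hr]
    simp only [Algebra.smul_def, map_pow]
    ring
  zero_mem' := ⟨0, 0, by simp⟩
  smul_mem' := by
    rintro c f ⟨n, p, hp⟩
    exact ⟨n, c * p, by rw [smul_comm, hp, map_mul, Algebra.smul_def]⟩

variable {k}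

lemma LaurentSeries.algebraMap_polynomial_injective :
    Function.Injective (algebraMap (Polynomial k) k⸨X⸩) :=
  FaithfulSMul.algebraMap_injective _ _

lemma LaurentSeries.algebraMap_powerSeries_injective :
    Function.Injective (algebraMap k⟦X⟧ k⸨X⸩) :=
  HahnSeries.ofPowerSeries_injective

lemma LaurentSeries.smul_algebraMap (p : Polynomial k) (f : k⟦X⟧) :
    p • algebraMap k⟦X⟧ k⸨X⸩ f = algebraMap k⟦X⟧ k⸨X⸩ (p * f) := by
  rw [map_mul, Algebra.smul_def]
  rfl

lemma LaurentSeries.X_pow_smul_injective (n : ℕ) :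
    Function.Injective fun f : k⸨X⸩ ↦ (Polynomial.X : Polynomial k) ^ n • f := by
  intro f g h
  simp only [Algebra.smul_def] at h
  exact mul_left_cancel₀ ((map_ne_zero_iff _ algebraMap_polynomial_injective).mpr
    (pow_ne_zero n Polynomial.X_ne_zero)) h

lemma LaurentSeries.powerSeriesSubmodule_sup :
    powerSeriesSubmodule k ⊔ laurentPolynomialSubmodule k = ⊤ := by
  refine eq_top_iff.mpr fun f _ ↦ ?_
  obtain ⟨⟨g, ⟨_, n, rfl⟩⟩, hg⟩ := IsLocalization.surj (Submonoid.powers (X : k⟦X⟧)) f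
  have hX : (Polynomial.X : Polynomial k) ^ n • f = algebraMap k⟦X⟧ k⸨X⸩ g := by
    rw [← hg, mul_comm, Algebra.smul_def, IsScalarTower.algebraMap_apply _ k⟦X⟧ k⸨X⸩, map_pow,
      show algebraMap (Polynomial k) k⟦X⟧ Polynomial.X = X from Polynomial.coe_X]
  let h : k⟦X⟧ := mk fun i ↦ coeff (i + n) g
  refine Submodule.mem_sup.mpr ⟨algebraMap k⟦X⟧ k⸨X⸩ h, ⟨h, rfl⟩, f - algebraMap k⟦X⟧ k⸨X⸩ h,
    ⟨n, trunc n g, ?_⟩, add_sub_cancel _ _⟩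
  rw [smul_sub, hX, smul_algebraMap, ← map_sub, Polynomial.coe_pow, Polynomial.coe_X,
    sub_eq_of_eq_add' (eq_X_pow_mul_shift_add_trunc n g)]
  rfl

lemma LaurentSeries.powerSeriesSubmodule_inf :
    powerSeriesSubmodule k ⊓ laurentPolynomialSubmodule k = 1 := by
  refine le_antisymm ?_ fun f hf ↦ ?_
  · rintro _ ⟨⟨f, rfl⟩, n, p, hp⟩
    have h : (X : k⟦X⟧) ^ n * f = p := by
      refine algebraMap_powerSeries_injective (Eq.trans ?_ hp)
      exact ((smul_algebraMap _ _).trans (by simp)).symm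
    obtain ⟨r, rfl⟩ : Polynomial.X ^ n ∣ p := by
      rw [Polynomial.X_pow_dvd_iff]
      intro d hd
      rw [← Polynomial.coeff_coe, ← h]
      exact X_pow_dvd_iff.mp (dvd_mul_right _ _) d hd
    refine Submodule.mem_one.mpr ⟨r, X_pow_smul_injective n ?_⟩
    exact Eq.trans (by simp only [Algebra.smul_def, map_mul]) hp.symm
  · obtain ⟨p, rfl⟩ := Submodule.mem_one.mp hf
    exact ⟨⟨p, rfl⟩, 0, p, by simp⟩

lemma eq_zero_of_forall_pow_dvd {R : Type*} [CommRing R] [IsDomain R] [WfDvdMonoid R]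
    {a b : R} (ha : ¬ IsUnit a) (h : ∀ n, a ^ n ∣ b) : b = 0 := by
  by_contra hb
  obtain ⟨n, hn⟩ := FiniteMultiplicity.of_not_isUnit ha hb
  exact hn (h _)

lemma LaurentSeries.eq_zero_of_mem_powerSeriesSubmodule :
    ∀ f ∈ powerSeriesSubmodule k, (∀ n, ∃ g ∈ powerSeriesSubmodule k,
      f = (Polynomial.X : Polynomial k) ^ n • g) → f = 0 := by
  rintro _ ⟨f, rfl⟩ h
  suffices f = 0 by rw [this, map_zero]
  refine eq_zero_of_forall_pow_dvd (X_prime (R := k)).not_isUnit fun n ↦ ?_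
  obtain ⟨_, ⟨g, rfl⟩, hg⟩ := h n
  refine ⟨g, algebraMap_powerSeries_injective (Eq.trans hg ?_)⟩
  exact (smul_algebraMap _ _).trans (by simp)

lemma LaurentSeries.eq_zero_of_mem_laurentPolynomialSubmodule :
    ∀ f ∈ laurentPolynomialSubmodule k, (∀ n, ∃ g ∈ laurentPolynomialSubmodule k,
      f = (Polynomial.X - Polynomial.C 1 : Polynomial k) ^ n • g) → f = 0 := by
  rintro f ⟨m, p, hp⟩ h
  have hprime : Prime (Polynomial.X - Polynomial.C 1 : Polynomial k) := Polynomial.prime_X_sub_C 1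
  have hX : ¬ (Polynomial.X - Polynomial.C 1 : Polynomial k) ∣ Polynomial.X := by
    rw [Polynomial.dvd_iff_isRoot]
    simp
  suffices p = 0 by
    refine X_pow_smul_injective m ?_
    simp only [hp, this, map_zero, smul_zero]
  refine eq_zero_of_forall_pow_dvd hprime.not_isUnit fun n ↦ ?_
  obtain ⟨g, ⟨l, r, hr⟩, rfl⟩ := h n
  refine hprime.pow_dvd_of_dvd_mul_left n (mt hprime.dvd_of_dvd_pow hX)
    (a := Polynomial.X ^ l) ⟨Polynomial.X ^ m * r, algebraMap_polynomial_injective ?_⟩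
  rw [map_mul, ← hp, map_mul, map_mul, ← hr]
  simp only [Algebra.smul_def]
  ring

end Laurent

/-- At a maximal ideal, the localization maps nontrivially to the completion. -/
theorem mem_ringCosupport_of_isMaximal {R : Type u} [CommRing R] [IsNoetherianRing R]
    (q : PrimeSpectrum R) [hq : q.asIdeal.IsMaximal] : q ∈ ringCosupport R := by
  let I := q.asIdeal
  have hI : I.FG := Ideal.fg_of_isNoetherianRing _
  have hcomplete := AdicCompletion.isAdicComplete_self I hI
  have hunit (s : I.primeCompl) : IsUnit (Algebra.ofId R (AdicCompletion I R) s) := by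
    obtain ⟨r, i, hi, h⟩ := hq.exists_inv s.2
    have hmem : algebraMap R (AdicCompletion I R) (r * s - 1) ∈
        (⊥ : Ideal (AdicCompletion I R)).jacobson := by
      refine IsAdicComplete.le_jacobson_bot (I.map (algebraMap R (AdicCompletion I R)))
        (Ideal.mem_map_of_mem _ ?_)
      rw [← h, sub_add_cancel_left]
      exact I.neg_mem hi
    refine isUnit_of_mul_isUnit_right (x := algebraMap R (AdicCompletion I R) r) ?_
    have := Ideal.mem_jacobson_bot.mp hmem 1
    simpa using this
  have hnontrivial : Nontrivial (AdicCompletion I R) :=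
    (AdicCompletion.evalOneₐ I).toRingHom.domain_nontrivial
  let j : Localization.AtPrime I →ₐ[R] AdicCompletion I R :=
    IsLocalization.liftAlgHom (M := I.primeCompl) hunit
  refine ⟨0, ?_⟩
  by_contra hsub
  rw [not_nontrivial_iff_subsingleton] at hsub
  let P := projectiveResolution (ModuleCat.of R (Localization.AtPrime I))
  rw [subsingleton_ext_iff P _ (j := 0) (by simp)] at hsub
  let p : P.complex.X 0 ⟶ ModuleCat.of R (Localization.AtPrime I) := P.π.f 0
  have hp : P.complex.d 1 0 ≫ p = 0 := P.complex_d_comp_π_f_zero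
  have hepi : Epi p := inferInstanceAs (Epi (P.π.f 0))
  obtain ⟨b, hb⟩ := hsub (p ≫ ModuleCat.ofHom j.toLinearMap) (by
    rw [zero_add, ← Category.assoc, hp, Limits.zero_comp])
  rw [P.complex.shape 0 0 (by simp), Limits.zero_comp] at hb
  have hj : ModuleCat.ofHom j.toLinearMap = 0 := by
    rw [← cancel_epi p, ← hb, Limits.comp_zero]
  have : j 1 = 0 := congrArg (fun l ↦ l.hom (1 : Localization.AtPrime I)) hj
  rw [map_one] at this
  exact one_ne_zero this

/-- If `R` is derived `t`-complete, then its cosupport is contained in `V((t))`. -/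
theorem mem_of_mem_ringCosupport {R : Type u} [CommRing R] [IsNoetherianRing R] {t : R}
    (ht : HasUniqueTails t R) {q : PrimeSpectrum R} (hq : q ∈ ringCosupport R) :
    t ∈ q.asIdeal := by
  by_contra htq
  obtain ⟨i, hi⟩ := hq
  refine not_subsingleton_iff_nontrivial.mpr hi ?_
  obtain ⟨v, hv⟩ := (IsLocalization.map_units (M := q.asIdeal.primeCompl)
    (Localization.AtPrime q.asIdeal) ⟨t, htq⟩).exists_right_inv
  refine subsingleton_ext_of_hasUniqueTails (t := t)
    (ModuleCat.ofHom (LinearMap.mulLeft R v)) ?_ (ht.adicCompletion _) i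
  ext x
  change t • (v * x) = x
  rw [Algebra.smul_def, ← mul_assoc, hv, one_mul]

lemma PowerSeries.ker_constantCoeff (A : Type*) [CommRing A] :
    RingHom.ker (constantCoeff (R := A)) = Ideal.span {PowerSeries.X} := by
  ext f
  rw [RingHom.mem_ker, Ideal.mem_span_singleton, X_dvd_iff]

/-- A prime of `A⟦X⟧` containing `X` is the preimage of a prime of `A`. -/
lemma PowerSeries.exists_comap_constantCoeff_eq {A : Type*} [CommRing A]
    {q : Ideal (PowerSeries A)} [hq : q.IsPrime] (hX : PowerSeries.X ∈ q) :
    ∃ p : Ideal A, p.IsPrime ∧ p.comap (constantCoeff (R := A)) = q := by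
  have hsurj : Function.Surjective (constantCoeff (R := A)) := constantCoeff_surj
  have hker : RingHom.ker (constantCoeff (R := A)) ≤ q := by
    rw [ker_constantCoeff, Ideal.span_singleton_le_iff_mem]
    exact hX
  refine ⟨q.map constantCoeff, Ideal.map_isPrime_of_surjective hsurj hker, ?_⟩
  rw [Ideal.comap_map_of_surjective' _ hsurj, sup_eq_left.mpr hker]

/-!
STATEMENT 10: For a field `k`, the cosupport of `S = k[x][[t]]` equals `V((t))`:
a prime `q` of `S` lies in the cosupport of `S` iff `t ∈ q`.
-/
theorem cosupport_powerSeries_over_polynomial (k : Type) [Field k] :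
    ∀ q : PrimeSpectrum (PowerSeries (Polynomial k)),
      q ∈ ringCosupport (PowerSeries (Polynomial k)) ↔
        (PowerSeries.X : PowerSeries (Polynomial k)) ∈ q.asIdeal := by
  intro q
  refine ⟨mem_of_mem_ringCosupport (PowerSeries.hasUniqueTails _), fun hX ↦ ?_⟩
  obtain ⟨p, hp, hpq⟩ := PowerSeries.exists_comap_constantCoeff_eq hX
  by_cases hp0 : p = ⊥
  · subst hp0
    have hmem (f) : f ∈ q.asIdeal ↔ PowerSeries.constantCoeff f = 0 := by
      rw [← hpq, Ideal.mem_comap, Ideal.mem_bot]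
    have hspan : q.asIdeal = Ideal.span {PowerSeries.X} := by
      rw [← hpq, ← PowerSeries.ker_constantCoeff]
      rfl
    have hcomplete : IsAdicComplete q.asIdeal (PowerSeries (Polynomial k)) :=
      hspan ▸ PowerSeries.isAdicComplete_span_X (Polynomial k)
    exact ⟨1, not_subsingleton_iff_nontrivial.mp <| PowerSeries.not_subsingleton_ext_one
      LaurentSeries.algebraMap_polynomial_injective LaurentSeries.powerSeriesSubmodule_sup
      LaurentSeries.powerSeriesSubmodule_inf Polynomial.X_ne_zero (Polynomial.X_sub_C_ne_zero 1)
      LaurentSeries.eq_zero_of_mem_powerSeriesSubmodule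
      LaurentSeries.eq_zero_of_mem_laurentPolynomialSubmodule q.asIdeal hmem
      (AdicCompletion.ofLinearEquiv q.asIdeal _).symm⟩
  · have := hp.isMaximal hp0
    have : q.asIdeal.IsMaximal :=
      hpq ▸ Ideal.comap_isMaximal_of_surjective _ PowerSeries.constantCoeff_surj
    exact mem_ringCosupport_of_isMaximal q
end
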